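/- Let K be an H-operator-valued kernel on X which is partially Hermitian with respect to the partition {X_s}_{s∈S} induced by the anchor. The following are equivalent: (1) K is Γ-invariant and there exists a partially positive semidefinite kernel L with K ≤_P L; (2) for each s ∈ S there exists a reproducing kernel Krein space ℛ_{K^s} with kernel K^s := K|_{X_s × X_s}, and, with D_s := span{K^s_x h : x ∈ X_s, h ∈ H_x}, there exists a family of linear maps Φ(α) : D_{d(α)} → D_{c(α)} (α ∈ Γ) satisfying Φ(αβ)|_{D_{d(β)}} = Φ(α)Φ(β)|_{D_{d(β)}} for composable pairs, [Φ(α)f, g] = [f, Φ(α*)g] for all f ∈ D_{d(α)}, g ∈ D_{c(α)}, and Φ(α)K^{d(α)}_x h = K^{c(α)}_{α·x} h for all α ∈ Γ, x ∈ X_{d(α)}, h ∈ H_x; (3) there exists a quadruple ({(𝒦_s, J_s)}, {D_s}, {V_x}, Φ) where ({(𝒦_s, J_s)}, {V_x}) is a minimal Krein space partial linearisation of K, D_s ⊆ 𝒦_s are dense subspaces containing all V_x H_x (x ∈ X_s), and Φ(α) : D_{d(α)} → D_{c(α)} are linear maps with the multiplicativity Φ(αβ)|_{D_{d(β)}} =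 Φ(α)Φ(β)|_{D_{d(β)}}, the adjoint relation [Φ(α)f, g] = [f, Φ(α*)g] for f ∈ D_{d(α)}, g ∈ D_{c(α)}, and Φ(α)V_x = V_{α·x} for all x ∈ X_{d(α)}. -/

import Mathlib

open scoped InnerProductSpace

noncomputable section

universe u uΓ uS v vO w

/-- A `*`-semigroupoid: partially defined multiplication (the product `mul α β`
is subject to the axioms only when `d α = c β`) together with an involution. -/
structure StarSgd (Γ : Type uΓ) (S : Type uS) where
  d : Γ → S
  c : Γ → S
  mul : Γ → Γ → Γ
  star : Γ → Γ
  d_mul : ∀ {α β : Γ}, d α = c β → d (mul α β) = d β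
  c_mul : ∀ {α β : Γ}, d α = c β → c (mul α β) = c α
  mul_assoc : ∀ {α β γ : Γ}, d α = c β → d β = c γ →
    mul α (mul β γ) = mul (mul α β) γ
  d_star : ∀ α, d (star α) = c α
  c_star : ∀ α, c (star α) = d α
  star_star : ∀ α, star (star α) = α
  star_mul : ∀ {α β : Γ}, d α = c β → star (mul α β) = mul (star β) (star α)

/-- A left action of a semigroupoid on a set `X`, with surjective anchor `a`;
`act α x` is subject to the axioms only when `d α = a x`. -/
structure SgdAction (Γ : Type uΓ) (S : Type uS) (X : Type v) (G : StarSgd Γ S) where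
  a : X → S
  a_surj : Function.Surjective a
  act : Γ → X → X
  a_act : ∀ {α : Γ} {x : X}, G.d α = a x → a (act α x) = G.c α
  act_mul : ∀ {α β : Γ} {x : X}, G.d β = a x → G.d α = G.c β →
    act (G.mul α β) x = act α (act β x)

variable {𝕜 : Type u} [RCLike 𝕜] {Γ : Type uΓ} {S : Type uS} {X : Type v}
  {O : Type vO} {E : O → Type w}
  [∀ o, NormedAddCommGroup (E o)] [∀ o, InnerProductSpace 𝕜 (E o)]
  [∀ o, CompleteSpace (E o)]

/-- Transport along an equality of indices: since the Hilbert bundle over `X`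
is given as a pullback `x ↦ E (p x)`, equal indices give literally the same
Hilbert space, and the transport is a linear isometry. -/
def castE (𝕜 : Type u) [RCLike 𝕜] {O : Type vO} (E : O → Type w)
    [∀ o, NormedAddCommGroup (E o)] [∀ o, InnerProductSpace 𝕜 (E o)]
    {o o' : O} (h : o = o') : E o ≃ₗᵢ[𝕜] E o' := by
  subst h; exact LinearIsometryEquiv.refl 𝕜 (E o)

variable {G : StarSgd Γ S} (A : SgdAction Γ S X G) (p : X → O)

/-- `K` is partially Hermitian with respect to the partition of `X` into the
fibres of the anchor map. -/
def PartHermitian (K : ∀ y x : X, E (p x) →L[𝕜] E (p y)) : Prop :=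
  ∀ x y : X, A.a x = A.a y → ContinuousLinearMap.adjoint (K x y) = K y x

/-- `K` is partially positive semidefinite with respect to the partition of
`X` into the fibres of the anchor map. -/
def PartPSD (K : ∀ y x : X, E (p x) →L[𝕜] E (p y)) : Prop :=
  PartHermitian A p K ∧
  ∀ (s : S) (n : ℕ) (x : Fin n → X), (∀ i, A.a (x i) = s) →
    ∀ h : ∀ i, E (p (x i)),
      0 ≤ RCLike.re (∑ i, ∑ j, ⟪K (x j) (x i) (h i), h j⟫_𝕜)

variable (hp : ∀ {α : Γ} {x : X}, G.d α = A.a x → p (A.act α x) = p x)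

/-- `K` is `Γ`-invariant: `K(α·x, y) = K(x, α*·y)`, expressed using the
transport isometries coming from the constancy of the bundle on orbits. -/
def GammaInvariant (K : ∀ y x : X, E (p x) →L[𝕜] E (p y)) : Prop :=
  ∀ (α : Γ) (x y : X) (hx : G.d α = A.a x) (hy : G.c α = A.a y) (k : E (p y)),
    castE 𝕜 E (hp hx) (K (A.act α x) y k) =
      K x (A.act (G.star α) y)
        ((castE 𝕜 E (hp ((G.d_star α).trans hy))).symm k)

/-- `K` is of bounded shift type: for every `α` there is `M_α ≥ 0` dominating
the shifted quadratic forms by the original ones (stated via finite families of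
points in the fibre `X_{d(α)}`). -/
def BoundedShiftType (K : ∀ y x : X, E (p x) →L[𝕜] E (p y)) : Prop :=
  ∀ α : Γ, ∃ M : ℝ, 0 ≤ M ∧
    ∀ (n : ℕ) (z : Fin n → X) (hz : ∀ i, G.d α = A.a (z i))
      (g : ∀ i, E (p (z i))),
      RCLike.re (∑ i, ∑ j, ⟪K (A.act α (z j)) (A.act α (z i))
          ((castE 𝕜 E (hp (hz i))).symm (g i)),
          (castE 𝕜 E (hp (hz j))).symm (g j)⟫_𝕜) ≤
        M * RCLike.re (∑ i, ∑ j, ⟪K (z j) (z i) (g i), g j⟫_𝕜)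

universe w'

/-- The partial order on partially Hermitian kernels with respect to the
anchor partition: `K ≤_P L` iff `L - K` is partially positive semidefinite. -/
def PKLE (K L : ∀ y x : X, E (p x) →L[𝕜] E (p y)) : Prop :=
  PartPSD A p (fun y x => L y x - K y x)

/-- Disjointness of two partially positive semidefinite kernels. -/
def PDisjoint (K₁ K₂ : ∀ y x : X, E (p x) →L[𝕜] E (p y)) : Prop :=
  ∀ P : ∀ y x : X, E (p x) →L[𝕜] E (p y),
    PartPSD A p P → PKLE A p P K₁ → PKLE A p P K₂ →
    ∀ y x : X, A.a x = A.a y → P y x = 0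

/-- A bundled Krein space over `𝕜`: a Hilbert space together with a
fundamental symmetry `J`; the indefinite inner product is `[h,k] = ⟪Jh,k⟫`. -/
structure KSp (𝕜 : Type u) [RCLike 𝕜] : Type (max u (w' + 1)) where
  carrier : Type w'
  [ng : NormedAddCommGroup carrier]
  [ip : InnerProductSpace 𝕜 carrier]
  [cs : CompleteSpace carrier]
  J : carrier →L[𝕜] carrier
  J_adj : ContinuousLinearMap.adjoint J = J
  J_sq : J.comp J = ContinuousLinearMap.id 𝕜 carrier

attribute [instance] KSp.ng KSp.ip KSp.cs

/-- Transport between the members of a bundle of Krein spaces along an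
equality of indices. -/
def castK (𝕜 : Type u) [RCLike 𝕜] {S : Type uS} (𝒦 : S → KSp.{u, w'} 𝕜)
    {s t : S} (h : s = t) : (𝒦 s).carrier ≃ₗᵢ[𝕜] (𝒦 t).carrier := by
  subst h; exact LinearIsometryEquiv.refl 𝕜 (𝒦 s).carrier

/-- A Krein space partial linearisation of `K` with respect to the anchor
partition: `K(x,y) = V_x* J_s V_y` on each fibre. -/
def IsPartKreinLin (K : ∀ y x : X, E (p x) →L[𝕜] E (p y))
    (𝒦 : S → KSp.{u, w'} 𝕜)
    (V : ∀ x : X, E (p x) →L[𝕜] (𝒦 (A.a x)).carrier) : Prop :=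
  ∀ (x y : X) (hxy : A.a y = A.a x) (k : E (p y)) (h : E (p x)),
    ⟪(K x y) k, h⟫_𝕜 = ⟪(𝒦 (A.a x)).J (castK 𝕜 𝒦 hxy (V y k)), V x h⟫_𝕜

/-- Minimality of a Krein space partial linearisation. -/
def IsMinimalPartKLin (𝒦 : S → KSp.{u, w'} 𝕜)
    (V : ∀ x : X, E (p x) →L[𝕜] (𝒦 (A.a x)).carrier) : Prop :=
  ∀ s : S, Dense (↑(Submodule.span 𝕜 (⋃ x : {x : X // A.a x = s},
    Set.range fun h : E (p x.val) => castK 𝕜 𝒦 x.2 (V x.val h))) :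
      Set (𝒦 s).carrier)

/-- A reproducing kernel Krein space of sections over the fibre `X_s`, with
kernel the restriction of `K`: a Krein space embedded injectively and linearly
into the sections on `X_s`, containing the kernel sections and with the Krein
reproducing property `⟨f(x), h⟩ = [f, K_x h] = ⟪J f, K_x h⟫`. -/
structure RKKSOn (𝕜 : Type u) [RCLike 𝕜] {Γ : Type uΓ} {S : Type uS}
    {X : Type v} {O : Type vO} (E : O → Type w)
    [∀ o, NormedAddCommGroup (E o)] [∀ o, InnerProductSpace 𝕜 (E o)]
    [∀ o, CompleteSpace (E o)]
    {G : StarSgd Γ S} (A : SgdAction Γ S X G) (p : X → O)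
    (K : ∀ y x : X, E (p x) →L[𝕜] E (p y)) (s : S) :
    Type (max u v w (w' + 1)) where
  carrier : Type w'
  [ng : NormedAddCommGroup carrier]
  [ip : InnerProductSpace 𝕜 carrier]
  [cs : CompleteSpace carrier]
  J : carrier →L[𝕜] carrier
  J_adj : ContinuousLinearMap.adjoint J = J
  J_sq : J.comp J = ContinuousLinearMap.id 𝕜 carrier
  emb : carrier →ₗ[𝕜] ∀ x : {x : X // A.a x = s}, E (p x.val)
  emb_inj : Function.Injective emb
  Kx : ∀ x : {x : X // A.a x = s}, E (p x.val) → carrier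
  emb_Kx : ∀ (x : {x : X // A.a x = s}) (h : E (p x.val))
    (y : {x : X // A.a x = s}), emb (Kx x h) y = K y.val x.val h
  repro : ∀ (f : carrier) (x : {x : X // A.a x = s}) (h : E (p x.val)),
    ⟪emb f x, h⟫_𝕜 = ⟪J f, Kx x h⟫_𝕜

attribute [instance] RKKSOn.ng RKKSOn.ip RKKSOn.cs

/-- The subspaces `D_s := span{K^s_x h}` of the reproducing kernel Krein
spaces. -/
def DspanK (K : ∀ y x : X, E (p x) →L[𝕜] E (p y))
    (R : ∀ s : S, RKKSOn.{u, uΓ, uS, v, vO, w, w'} 𝕜 E A p K s) (s : S) :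
    Submodule 𝕜 (R s).carrier :=
  Submodule.span 𝕜 (⋃ x : {x : X // A.a x = s}, Set.range ((R s).Kx x))

/-- Transport between the subspaces `D_s` along an equality of indices. -/
def castDK {K : ∀ y x : X, E (p x) →L[𝕜] E (p y)}
    {R : ∀ s : S, RKKSOn.{u, uΓ, uS, v, vO, w, w'} 𝕜 E A p K s}
    {s t : S} (h : s = t) : ↥(DspanK A p K R s) ≃ₗ[𝕜] ↥(DspanK A p K R t) := by
  subst h; exact LinearEquiv.refl 𝕜 _

/-- Transport between the members of a bundle of subspaces of a bundle of
Krein spaces along an equality of indices. -/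
def castSubK {𝕜 : Type u} [RCLike 𝕜] {S : Type uS} {𝒦 : S → KSp.{u, w'} 𝕜}
    (D : ∀ s : S, Submodule 𝕜 (𝒦 s).carrier) {s t : S} (h : s = t) :
    ↥(D s) ≃ₗ[𝕜] ↥(D t) := by
  subst h; exact LinearEquiv.refl 𝕜 ↥(D s)

/-- Transport between the members of a bundle of reproducing kernel Krein
spaces along an equality of indices. -/
def castRK {K : ∀ y x : X, E (p x) →L[𝕜] E (p y)}
    (R : ∀ s : S, RKKSOn.{u, uΓ, uS, v, vO, w, w'} 𝕜 E A p K s)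
    {s t : S} (h : s = t) : (R s).carrier ≃ₗᵢ[𝕜] (R t).carrier := by
  subst h; exact LinearIsometryEquiv.refl 𝕜 (R s).carrier

/-- A generalised `Γ`-invariant Krein space linearisation of `K`: a minimal
Krein space partial linearisation together with dense subspaces `D_s`
containing the ranges of the `V_x`, and a generalised `*`-representation `Φ`
by (possibly unbounded) operators `Φ(α) : D_{d(α)} → D_{c(α)}` with
`Φ(α) V_x = V_{α·x}`. -/
structure GenInvKLin (𝕜 : Type u) [RCLike 𝕜] {Γ : Type uΓ} {S : Type uS}
    {X : Type v} {O : Type vO} (E : O → Type w)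
    [∀ o, NormedAddCommGroup (E o)] [∀ o, InnerProductSpace 𝕜 (E o)]
    [∀ o, CompleteSpace (E o)]
    {G : StarSgd Γ S} (A : SgdAction Γ S X G) (p : X → O)
    (hp : ∀ {α : Γ} {x : X}, G.d α = A.a x → p (A.act α x) = p x)
    (K : ∀ y x : X, E (p x) →L[𝕜] E (p y)) :
    Type (max u uΓ uS v w (w' + 1)) where
  Ksp : S → KSp.{u, w'} 𝕜
  D : ∀ s : S, Submodule 𝕜 (Ksp s).carrier
  dense_D : ∀ s : S, Dense (D s : Set (Ksp s).carrier)
  V : ∀ x : X, E (p x) →L[𝕜] (Ksp (A.a x)).carrier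
  mem_D : ∀ (x : X) (h : E (p x)), V x h ∈ D (A.a x)
  lin : ∀ (x y : X) (hxy : A.a y = A.a x) (k : E (p y)) (h : E (p x)),
    ⟪(K x y) k, h⟫_𝕜 = ⟪(Ksp (A.a x)).J (castK 𝕜 Ksp hxy (V y k)), V x h⟫_𝕜
  Φ : ∀ α : Γ, ↥(D (G.d α)) →ₗ[𝕜] ↥(D (G.c α))
  Φ_mul : ∀ (α β : Γ) (hc : G.d α = G.c β) (f : ↥(D (G.d β))),
    Φ (G.mul α β) (castSubK D (G.d_mul hc).symm f) =
      castSubK D (G.c_mul hc).symm (Φ α (castSubK D hc.symm (Φ β f)))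
  Φ_adj : ∀ (α : Γ) (f : ↥(D (G.d α))) (g : ↥(D (G.c α))),
    ⟪(Ksp (G.c α)).J ↑(Φ α f), (g : (Ksp (G.c α)).carrier)⟫_𝕜 =
      ⟪(Ksp (G.d α)).J ↑f,
        ((castSubK D (G.c_star α)
          (Φ (G.star α) (castSubK D (G.d_star α).symm g))) :
            (Ksp (G.d α)).carrier)⟫_𝕜
  Φ_shift : ∀ (α : Γ) (x : X) (hx : G.d α = A.a x) (h : E (p x)),
    ((Φ α (castSubK D hx.symm ⟨V x h, mem_D x h⟩)) : (Ksp (G.c α)).carrier) =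
      castK 𝕜 Ksp (A.a_act hx) (V (A.act α x) ((castE 𝕜 E (hp hx)).symm h))

namespace KreinAux

/-- Scalar majorant of the iteration `Y ↦ (T + Y²) / 2`. -/
def sqrtMajorant : ℕ → ℝ
  | 0 => 0
  | n + 1 => (1 + sqrtMajorant n ^ 2) / 2

/-- The iteration `Y ↦ (T + Y²) / 2`, whose limit `Y` satisfies `(1 - Y)² = 1 - T`. -/
def sqrtIter {R : Type*} [NormedRing R] [NormedAlgebra ℝ R] (T : R) : ℕ → R
  | 0 => 0
  | n + 1 => (1 / 2 : ℝ) • (T + sqrtIter T n * sqrtIter T n)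

lemma sqrtMajorant_nonneg (n : ℕ) : 0 ≤ sqrtMajorant n := by
  cases n <;> simp only [sqrtMajorant] <;> positivity

lemma sqrtMajorant_le_one (n : ℕ) : sqrtMajorant n ≤ 1 := by
  induction n with
  | zero => simp [sqrtMajorant]
  | succ n ih => simp only [sqrtMajorant]; nlinarith [sqrtMajorant_nonneg n]

lemma sqrtMajorant_mono : Monotone sqrtMajorant :=
  monotone_nat_of_le_succ fun n => by
    simp only [sqrtMajorant]; nlinarith [sq_nonneg (sqrtMajorant n - 1)]

section NormedRing

variable {R : Type*} [NormedRing R] [NormedAlgebra ℝ R]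

lemma norm_sqrtIter_le {T : R} (hT : ‖T‖ ≤ 1) (n : ℕ) : ‖sqrtIter T n‖ ≤ sqrtMajorant n := by
  induction n with
  | zero => simp [sqrtIter, sqrtMajorant]
  | succ n ih =>
    simp only [sqrtIter, sqrtMajorant, norm_smul]
    have h1 := norm_add_le T (sqrtIter T n * sqrtIter T n)
    have h2 := norm_mul_le (sqrtIter T n) (sqrtIter T n)
    have h3 := mul_self_le_mul_self (norm_nonneg _) ih
    norm_num
    nlinarith

lemma commute_sqrtIter {T A : R} (h : Commute A T) (n : ℕ) : Commute A (sqrtIter T n) := by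
  induction n with
  | zero => simp [sqrtIter]
  | succ n ih => exact (h.add_right (ih.mul_right ih)).smul_right _

lemma norm_sqrtIter_succ_sub_le {T : R} (hT : ‖T‖ ≤ 1) (n : ℕ) :
    ‖sqrtIter T (n + 1) - sqrtIter T n‖ ≤ sqrtMajorant (n + 1) - sqrtMajorant n := by
  induction n with
  | zero =>
    simp only [sqrtIter, sqrtMajorant, norm_smul, mul_zero, add_zero, sub_zero]
    norm_num
    linarith
  | succ n ih =>
    have hc : Commute (sqrtIter T n) (sqrtIter T (n + 1)) :=
      commute_sqrtIter (commute_sqrtIter (Commute.refl T) n).symm (n + 1)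
    have key : sqrtIter T (n + 2) - sqrtIter T (n + 1) = (1 / 2 : ℝ) •
        ((sqrtIter T (n + 1) + sqrtIter T n) * (sqrtIter T (n + 1) - sqrtIter T n)) := by
      rw [← hc.symm.mul_self_sub_mul_self_eq]
      conv_lhs => rw [sqrtIter, sqrtIter.eq_2 T n, ← smul_sub, add_sub_add_left_eq_sub]
      rw [sqrtIter]
    have hm : sqrtMajorant (n + 2) - sqrtMajorant (n + 1) = 1 / 2 *
        ((sqrtMajorant (n + 1) + sqrtMajorant n) * (sqrtMajorant (n + 1) - sqrtMajorant n)) := by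
      conv_lhs => rw [sqrtMajorant, sqrtMajorant.eq_2 n]
      rw [show sqrtMajorant (n + 1) = (1 + sqrtMajorant n ^ 2) / 2 from rfl]
      ring
    rw [show n + 1 + 1 = n + 2 from rfl, key, hm, norm_smul]
    have h0 : ‖sqrtIter T (n + 1) + sqrtIter T n‖ ≤ sqrtMajorant (n + 1) + sqrtMajorant n :=
      (norm_add_le _ _).trans (add_le_add (norm_sqrtIter_le hT _) (norm_sqrtIter_le hT _))
    rw [show ‖(1 / 2 : ℝ)‖ = 1 / 2 by norm_num]
    gcongr
    refine (norm_mul_le _ _).trans ?_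
    gcongr
    exact (norm_nonneg _).trans h0

lemma cauchySeq_sqrtIter {T : R} (hT : ‖T‖ ≤ 1) : CauchySeq (sqrtIter T) := by
  refine cauchySeq_of_summable_dist ?_
  refine Summable.of_nonneg_of_le (fun _ => dist_nonneg)
    (fun n => (dist_comm _ _).trans_le
      ((dist_eq_norm _ _).trans_le (norm_sqrtIter_succ_sub_le hT n))) ?_
  refine summable_of_sum_range_le (c := 1)
    (fun n => sub_nonneg.2 (sqrtMajorant_mono n.le_succ)) fun n => ?_
  rw [Finset.sum_range_sub]
  simpa [sqrtMajorant] using sqrtMajorant_le_one n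

/-- In a real Banach algebra, `1 - T` has a square root `1 - Y` with `‖Y‖ ≤ 1` whenever
`‖T‖ ≤ 1`; here `Y` is the limit of `sqrtIter T`. -/
lemma exists_sqrt_one_sub [CompleteSpace R] {T : R} (hT : ‖T‖ ≤ 1) :
    ∃ Y : R, Filter.Tendsto (sqrtIter T) Filter.atTop (nhds Y) ∧ ‖Y‖ ≤ 1 ∧
      (1 - Y) * (1 - Y) = 1 - T ∧ ∀ A, Commute A T → Commute A Y := by
  obtain ⟨Y, hY⟩ := cauchySeq_tendsto_of_complete (cauchySeq_sqrtIter hT)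
  refine ⟨Y, hY, ?_, ?_, fun A hA => ?_⟩
  · exact le_of_tendsto hY.norm (Filter.Eventually.of_forall fun n =>
      (norm_sqrtIter_le hT n).trans (sqrtMajorant_le_one n))
  · have h1 : Filter.Tendsto (fun n => sqrtIter T (n + 1)) Filter.atTop (nhds Y) :=
      hY.comp (Filter.tendsto_add_atTop_nat 1)
    have h2 : Filter.Tendsto (fun n => sqrtIter T (n + 1)) Filter.atTop
        (nhds ((1 / 2 : ℝ) • (T + Y * Y))) :=
      ((hY.mul hY).const_add T).const_smul (1 / 2 : ℝ)
    have h3 := tendsto_nhds_unique h1 h2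
    have h4 : Y + Y = T + Y * Y := by
      rw [← two_smul ℝ Y]
      conv_lhs => rw [h3]
      rw [smul_smul]; norm_num
    have : (1 - Y) * (1 - Y) = 1 - (Y + Y) + Y * Y := by noncomm_ring
    rw [this, h4]; abel
  · exact tendsto_nhds_unique (hY.const_mul A)
      ((hY.mul_const A).congr fun n => (commute_sqrtIter hA n).eq.symm)

lemma isSelfAdjoint_sqrtIter [StarRing R] [StarModule ℝ R] {T : R} (hT : IsSelfAdjoint T) (n : ℕ) :
    IsSelfAdjoint (sqrtIter T n) := by
  induction n with
  | zero => exact IsSelfAdjoint.zero R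
  | succ n ih =>
    refine IsSelfAdjoint.smul (IsSelfAdjoint.all _) (hT.add ?_)
    rw [isSelfAdjoint_iff, star_mul, ih.star_eq]

end NormedRing

section Hilbert

variable {H : Type w} [NormedAddCommGroup H] [InnerProductSpace 𝕜 H]
  [CompleteSpace H]

/-- A self-adjoint contraction `B` admits a self-adjoint `C` commuting with it with `C⁴ = B²`. -/
lemma exists_fourth_root_sq {B : H →L[𝕜] H} (hB : IsSelfAdjoint B) (hB1 : ‖B‖ ≤ 1) :
    ∃ C : H →L[𝕜] H, IsSelfAdjoint C ∧ Commute B C ∧ C * C * (C * C) = B * B := by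
  let _ : NormedAlgebra ℝ (H →L[𝕜] H) := NormedAlgebra.restrictScalars ℝ 𝕜 _
  have : StarModule ℝ (H →L[𝕜] H) := ⟨fun r A => by
    have h : ∀ A : H →L[𝕜] H, r • A = (r : 𝕜) • A := fun A => rfl
    rw [h, star_smul, star_trivial r, h (star A)]; simp⟩
  have hsym : ∀ x y, ⟪B x, y⟫_𝕜 = ⟪x, B y⟫_𝕜 := hB.isSymmetric
  have hT : ‖1 - B * B‖ ≤ 1 := by
    refine ContinuousLinearMap.opNorm_le_bound _ zero_le_one fun x => ?_
    have h1 : ‖B (B x)‖ ≤ ‖B x‖ := by simpa using B.le_of_opNorm_le hB1 (B x)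
    have h2 : ‖x - B (B x)‖ ^ 2 = ‖x‖ ^ 2 - 2 * ‖B x‖ ^ 2 + ‖B (B x)‖ ^ 2 := by
      rw [@norm_sub_sq 𝕜, ← hsym, inner_self_eq_norm_sq]
    have h3 : ‖x - B (B x)‖ ^ 2 ≤ ‖x‖ ^ 2 := by
      nlinarith [norm_nonneg (B x), norm_nonneg (B (B x))]
    simpa using (sq_le_sq₀ (norm_nonneg _) (norm_nonneg _)).1 h3
  have hTs : IsSelfAdjoint (1 - B * B) :=
    (IsSelfAdjoint.one _).sub (by rw [isSelfAdjoint_iff, star_mul, hB.star_eq])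
  obtain ⟨Y, hY, hY1, hYm, hYc⟩ := exists_sqrt_one_sub hT
  have hYs : IsSelfAdjoint Y := (isClosed_eq continuous_star continuous_id).mem_of_tendsto hY
    (Filter.Eventually.of_forall (isSelfAdjoint_sqrtIter hTs))
  obtain ⟨Z, hZ, hZ1, hZm, hZc⟩ := exists_sqrt_one_sub hY1
  have hZs : IsSelfAdjoint Z := (isClosed_eq continuous_star continuous_id).mem_of_tendsto hZ
    (Filter.Eventually.of_forall (isSelfAdjoint_sqrtIter hYs))
  refine ⟨1 - Z, (IsSelfAdjoint.one _).sub hZs, ?_, ?_⟩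
  · refine (Commute.one_right B).sub_right (hZc _ (hYc _ ?_))
    exact (Commute.one_right B).sub_right ((Commute.refl B).mul_right (Commute.refl B))
  · rw [hZm, hYm, sub_sub_cancel]

lemma denseRange_of_inner_eq_zero {F : Type*} [AddCommGroup F] [Module 𝕜 F] (T : F →ₗ[𝕜] H)
    (h : ∀ x : H, (∀ f, ⟪T f, x⟫_𝕜 = 0) → x = 0) : DenseRange T := by
  have : (LinearMap.range T).topologicalClosure = ⊤ := by
    rw [Submodule.topologicalClosure_eq_top_iff, eq_bot_iff]
    intro x hx
    exact h x fun f => (Submodule.mem_orthogonal _ _).1 hx _ ⟨f, rfl⟩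
  have h2 := (Submodule.dense_iff_topologicalClosure_eq_top).2 this
  rwa [LinearMap.coe_range] at h2

/-- A self-adjoint contraction is the Gram operator of a Krein space. -/
lemma exists_kreinSpace_of_gram {B : H →L[𝕜] H} (hB : IsSelfAdjoint B) (hB1 : ‖B‖ ≤ 1) :
    ∃ (Ks : KSp.{u, w} 𝕜) (C : H →L[𝕜] Ks.carrier), DenseRange C ∧
      ∀ f g, ⟪Ks.J (C f), C g⟫_𝕜 = ⟪B f, g⟫_𝕜 := by
  obtain ⟨C, hC, hBC, hC4⟩ := exists_fourth_root_sq hB hB1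
  have hBs : ∀ x y, ⟪B x, y⟫_𝕜 = ⟪x, B y⟫_𝕜 := hB.isSymmetric
  have hCs : ∀ x y, ⟪C x, y⟫_𝕜 = ⟪x, C y⟫_𝕜 := hC.isSymmetric
  have hcomm : ∀ x, B (C x) = C (B x) := fun x => DFunLike.congr_fun hBC.eq x
  have h4 : ∀ x, C (C (C (C x))) = B (B x) := fun x => DFunLike.congr_fun hC4 x
  have hBB : ∀ x y, ⟪B x, B y⟫_𝕜 = ⟪C (C x), C (C y)⟫_𝕜 := fun x y => by
    rw [← hBs, ← hCs, ← hCs, h4]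
  have hker : ∀ x, C (C x) = 0 → C x = 0 := fun x hx => by
    rw [← inner_self_eq_zero (𝕜 := 𝕜), hCs, hx, inner_zero_right]
  have hkerB : ∀ x, C x = 0 → B x = 0 := fun x hx => by
    rw [← inner_self_eq_zero (𝕜 := 𝕜), hBB, hx]; simp
  let N : Submodule 𝕜 H := (LinearMap.ker C.toLinearMap)ᗮ
  have hNz : ∀ x ∈ N, C x = 0 → x = 0 := fun x hx h => by
    rw [← inner_self_eq_zero (𝕜 := 𝕜)]
    exact (Submodule.mem_orthogonal _ _).1 hx x h
  have hCN : ∀ x, C x ∈ N := fun x => (Submodule.mem_orthogonal _ _).2 fun y hy => by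
    rw [← hCs, show C y = 0 from hy, inner_zero_left]
  have hBN : ∀ x, B x ∈ N := fun x => (Submodule.mem_orthogonal _ _).2 fun y hy => by
    rw [← hBs, hkerB y hy, inner_zero_left]
  let C' : H →L[𝕜] N := C.codRestrict N hCN
  let B' : H →L[𝕜] N := B.codRestrict N hBN
  let e : H →L[𝕜] N := C'.comp C
  have hC'd : DenseRange C' := denseRange_of_inner_eq_zero (C' : H →ₗ[𝕜] N) fun x hx =>
    Subtype.ext (hNz x x.2 (ext_inner_left 𝕜 fun y => by
      rw [← hCs, inner_zero_right]; exact hx y))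
  have hed : DenseRange e := denseRange_of_inner_eq_zero (e : H →ₗ[𝕜] N) fun x hx =>
    Subtype.ext (hNz x x.2 (hker _ (ext_inner_left 𝕜 fun y => by
      rw [← hCs, ← hCs, inner_zero_right]; exact hx y)))
  let J : N →L[𝕜] N := (B' : H →ₗ[𝕜] N).extendOfNorm (e : H →ₗ[𝕜] N)
  have hJ : ∀ x, J (e x) = B' x := fun x =>
    LinearMap.extendOfNorm_eq (f := (B' : H →ₗ[𝕜] N)) (e := (e : H →ₗ[𝕜] N)) hed
      ⟨1, fun y => by
        rw [one_mul]
        refine le_of_eq ?_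
        rw [← sq_eq_sq₀ (norm_nonneg _) (norm_nonneg _),
          ← inner_self_eq_norm_sq (𝕜 := 𝕜), ← inner_self_eq_norm_sq (𝕜 := 𝕜)]
        exact congrArg RCLike.re (hBB y y)⟩ x
  have hJs : ∀ x y, ⟪J x, y⟫_𝕜 = ⟪x, J y⟫_𝕜 := by
    intro x y
    refine hed.induction_on₂ (p := fun x y => ⟪J x, y⟫_𝕜 = ⟪x, J y⟫_𝕜)
      (isClosed_eq (by fun_prop) (by fun_prop)) (fun f g => ?_) x y
    rw [hJ, hJ]
    change ⟪B f, C (C g)⟫_𝕜 = ⟪C (C f), B g⟫_𝕜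
    rw [hBs, hcomm, hcomm, hCs, hCs]
  have hJJ : ∀ x, J (J x) = x := fun x =>
    hed.eq_of_inner_left 𝕜 fun g => by
      refine hed.induction_on (p := fun x => ⟪J (J x), e g⟫_𝕜 = ⟪x, e g⟫_𝕜) x
        (isClosed_eq (by fun_prop) (by fun_prop)) fun f => ?_
      rw [hJs, hJ, hJ]
      exact hBB f g
  refine ⟨{ carrier := N, J := J, J_adj := ?_, J_sq := ContinuousLinearMap.ext hJJ }, C', hC'd,
    fun f g => ?_⟩
  · exact ((ContinuousLinearMap.eq_adjoint_iff _ _).2 hJs).symm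
  · have hz : C (J (C' f) : H) - B f = 0 := by
      refine hNz _ (N.sub_mem (hCN _) (hBN _)) (ext_inner_right 𝕜 fun y => ?_)
      have h1 : ⟪(J (C' f) : H), C (C y)⟫_𝕜 = ⟪C f, B y⟫_𝕜 := by
        have := hJs (C' f) (e y)
        rw [hJ] at this
        exact this
      rw [hCs, inner_sub_left, hCs, h1, hBs, hcomm, ← hCs f, sub_self, inner_zero_left]
    have hJC : ⟪(J (C' f) : H), C g⟫_𝕜 = ⟪B f, g⟫_𝕜 := by rw [← hCs, sub_eq_zero.1 hz]
    exact hJC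

/-- The Hilbert space completion of a positive semidefinite form. -/
lemma exists_hilbert_of_core {F : Type w'} [AddCommGroup F] [Module 𝕜 F]
    (cd : PreInnerProductSpace.Core 𝕜 F) :
    ∃ (H : Type w') (_ : NormedAddCommGroup H) (_ : InnerProductSpace 𝕜 H) (_ : CompleteSpace H)
      (T : F →ₗ[𝕜] H), DenseRange T ∧ ∀ f g, ⟪T f, T g⟫_𝕜 = cd.inner f g := by
  let _ : SeminormedAddCommGroup F := @InnerProductSpace.Core.toSeminormedAddCommGroup 𝕜 F _ _ _ cd
  let _ : InnerProductSpace 𝕜 F := InnerProductSpace.ofCore cd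
  refine ⟨UniformSpace.Completion F, inferInstance, inferInstance, inferInstance,
    (UniformSpace.Completion.toComplL : F →L[𝕜] UniformSpace.Completion F).toLinearMap,
    UniformSpace.Completion.denseRange_coe, fun f g => ?_⟩
  exact UniformSpace.Completion.inner_coe f g

/-- The sum of two positive semidefinite forms. -/
@[reducible]
def addCore {F : Type*} [AddCommGroup F] [Module 𝕜 F] (l m : PreInnerProductSpace.Core 𝕜 F) :
    PreInnerProductSpace.Core 𝕜 F where
  inner f g := l.inner f g + m.inner f g
  conj_inner_symm f g := by rw [map_add, l.conj_inner_symm, m.conj_inner_symm]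
  re_inner_nonneg f := by
    rw [map_add]; exact add_nonneg (l.re_inner_nonneg f) (m.re_inner_nonneg f)
  add_left f g h := by rw [l.add_left, m.add_left]; ring
  smul_left f g r := by rw [l.smul_left, m.smul_left]; ring

/-- The difference of two positive semidefinite forms is realised in a Krein space. -/
lemma exists_kreinSpace_of_cores {F : Type w'} [AddCommGroup F] [Module 𝕜 F]
    (l m : PreInnerProductSpace.Core 𝕜 F) :
    ∃ (Ks : KSp.{u, w'} 𝕜) (T : F →ₗ[𝕜] Ks.carrier) (M : ℝ), DenseRange T ∧
      (∀ f, ‖T f‖ ^ 2 ≤ M ^ 2 * RCLike.re (l.inner f f + m.inner f f)) ∧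
      ∀ f g, ⟪Ks.J (T f), T g⟫_𝕜 = l.inner f g - m.inner f g := by
  obtain ⟨H, _, _, _, T, hTd, hT⟩ := exists_hilbert_of_core (addCore l m)
  obtain ⟨H₁, _, _, _, T₁, -, hT₁⟩ := exists_hilbert_of_core l
  have hnorm : ∀ f, ‖T₁ f‖ ≤ 1 * ‖T f‖ := fun f => by
    rw [one_mul, ← sq_le_sq₀ (norm_nonneg _) (norm_nonneg _), ← inner_self_eq_norm_sq (𝕜 := 𝕜),
      ← inner_self_eq_norm_sq (𝕜 := 𝕜), hT, hT₁]
    change RCLike.re (l.inner f f) ≤ RCLike.re (l.inner f f + m.inner f f)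
    rw [map_add]
    linarith [m.re_inner_nonneg f]
  let P : H →L[𝕜] H₁ := T₁.extendOfNorm T
  have hP : ∀ f, P (T f) = T₁ f := LinearMap.extendOfNorm_eq hTd ⟨1, hnorm⟩
  have hP1 : ‖P‖ ≤ 1 := LinearMap.opNorm_extendOfNorm_le hTd zero_le_one hnorm
  let Q : H →L[𝕜] H := (ContinuousLinearMap.adjoint P).comp P
  have hQ : ∀ x y, ⟪Q x, y⟫_𝕜 = ⟪P x, P y⟫_𝕜 := fun x y =>
    ContinuousLinearMap.adjoint_inner_left P y (P x)
  have hQs : ∀ x y, ⟪Q x, y⟫_𝕜 = ⟪x, Q y⟫_𝕜 := fun x y => by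
    rw [hQ, ← inner_conj_symm, ← hQ, inner_conj_symm]
  let B : H →L[𝕜] H := (2 : 𝕜) • Q - 1
  have hBi : ∀ x y, ⟪B x, y⟫_𝕜 = 2 * ⟪P x, P y⟫_𝕜 - ⟪x, y⟫_𝕜 := fun x y => by
    simp [B, inner_sub_left, inner_smul_left, hQ, map_ofNat]
  have hB : IsSelfAdjoint B := by
    rw [ContinuousLinearMap.isSelfAdjoint_iff_isSymmetric]
    intro x y
    change ⟪B x, y⟫_𝕜 = ⟪x, B y⟫_𝕜
    rw [hBi, ← hQ, hQs]
    simp [B, inner_sub_right, inner_smul_right]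
  have hB1 : ‖B‖ ≤ 1 := by
    refine ContinuousLinearMap.opNorm_le_bound _ zero_le_one fun x => ?_
    have h1 : ‖Q x‖ ≤ ‖P x‖ := by
      have := (ContinuousLinearMap.adjoint P).le_of_opNorm_le (c := 1) (by simpa using hP1) (P x)
      rwa [one_mul] at this
    have h2 : ‖(2 : 𝕜) • Q x - x‖ ^ 2 = 4 * ‖Q x‖ ^ 2 - 4 * ‖P x‖ ^ 2 + ‖x‖ ^ 2 := by
      rw [@norm_sub_sq 𝕜, inner_smul_left, hQ, norm_smul, inner_self_eq_norm_sq_to_K]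
      norm_cast
      simp
      ring
    have h3 : ‖(2 : 𝕜) • Q x - x‖ ^ 2 ≤ ‖x‖ ^ 2 := by
      nlinarith [norm_nonneg (P x), norm_nonneg (Q x)]
    rw [one_mul]
    exact (sq_le_sq₀ (norm_nonneg _) (norm_nonneg _)).1 h3
  obtain ⟨Ks, C, hCd, hC⟩ := exists_kreinSpace_of_gram hB hB1
  refine ⟨Ks, C.toLinearMap ∘ₗ T, ‖C‖, hCd.comp hTd C.continuous, fun f => ?_, fun f g => ?_⟩
  · have h1 : RCLike.re (l.inner f f + m.inner f f) = ‖T f‖ ^ 2 := by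
      rw [← inner_self_eq_norm_sq (𝕜 := 𝕜), hT]; rfl
    rw [h1, ← mul_pow]
    exact pow_le_pow_left₀ (norm_nonneg _) (C.le_opNorm _) 2
  · change ⟪Ks.J (C (T f)), C (T g)⟫_𝕜 = _
    rw [hC, hBi, hP, hP, hT₁, hT]
    change 2 * l.inner f g - (l.inner f g + m.inner f g) = _
    ring

end Hilbert

section Kernel

variable {ι : Type v} {M : ι → Type w} [∀ i, NormedAddCommGroup (M i)]
  [∀ i, InnerProductSpace 𝕜 (M i)]

open Classical in
/-- The sesquilinear form on finitely supported sections induced by an operator-valued kernel. -/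
def kernelForm (L : ∀ y x : ι, M x →L[𝕜] M y) (f g : Π₀ i, M i) : 𝕜 :=
  DFinsupp.lsum ℕ (fun y => innerₛₗ 𝕜 (DFinsupp.lsum ℕ (fun x => (L y x).toLinearMap) f)) g

section

variable (L : ∀ y x : ι, M x →L[𝕜] M y)

lemma kernelForm_add_left (f₁ f₂ g : Π₀ i, M i) :
    kernelForm L (f₁ + f₂) g = kernelForm L f₁ g + kernelForm L f₂ g := by
  classical
  simp only [kernelForm, map_add]
  rw [← LinearMap.add_apply, ← map_add]
  rfl

lemma kernelForm_smul_left (r : 𝕜) (f g : Π₀ i, M i) :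
    kernelForm L (r • f) g = starRingEnd 𝕜 r * kernelForm L f g := by
  classical
  simp only [kernelForm]
  rw [← smul_eq_mul, ← LinearMap.smul_apply]
  congr 1
  refine DFinsupp.lhom_ext fun i h => ?_
  simp only [DFinsupp.lsum_single, LinearMap.smul_apply, innerₛₗ_apply_apply, map_smul,
    inner_smul_left, smul_eq_mul]

open Classical in
lemma kernelForm_single_single (x y : ι) (h : M x) (k : M y) :
    kernelForm L (DFinsupp.single x h) (DFinsupp.single y k) = ⟪L y x h, k⟫_𝕜 := by
  simp only [kernelForm, DFinsupp.lsum_single, innerₛₗ_apply_apply, ContinuousLinearMap.coe_coe]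

lemma kernelForm_zero_left (g : Π₀ i, M i) : kernelForm L 0 g = 0 := by
  simpa using kernelForm_smul_left L 0 0 g

open Classical in
lemma kernelForm_eq_sum (f g : Π₀ i, M i) :
    kernelForm L f g = ∑ x ∈ f.support, ∑ y ∈ g.support, ⟪L y x (f x), g y⟫_𝕜 := by
  have hr : ∀ (s : Finset ι) (f : Π₀ i, M i) (G : ι → Π₀ i, M i),
      kernelForm L f (∑ i ∈ s, G i) = ∑ i ∈ s, kernelForm L f (G i) := fun s f G => map_sum _ _ _
  have hl : ∀ (s : Finset ι) (G : ι → Π₀ i, M i) (g : Π₀ i, M i),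
      kernelForm L (∑ i ∈ s, G i) g = ∑ i ∈ s, kernelForm L (G i) g := by
    intro s G g
    induction s using Finset.induction_on with
    | empty => simpa using kernelForm_zero_left L g
    | insert a s ha ih => rw [Finset.sum_insert ha, Finset.sum_insert ha, kernelForm_add_left, ih]
  conv_lhs => rw [← DFinsupp.sum_single (f := f), ← DFinsupp.sum_single (f := g)]
  simp only [DFinsupp.sum, hl, hr, kernelForm_single_single]

end

/-- The positive semidefinite form on finitely supported sections induced by a Hermitian
positive semidefinite kernel. -/
@[reducible]
def kernelCore (L : ∀ y x : ι, M x →L[𝕜] M y)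
    (hL : ∀ x y h k, ⟪L y x h, k⟫_𝕜 = ⟪h, L x y k⟫_𝕜)
    (hpos : ∀ (n : ℕ) (x : Fin n → ι) (h : ∀ i, M (x i)),
      0 ≤ RCLike.re (∑ i, ∑ j, ⟪L (x j) (x i) (h i), h j⟫_𝕜)) :
    PreInnerProductSpace.Core 𝕜 (Π₀ i, M i) where
  inner := kernelForm L
  conj_inner_symm f g := by
    classical
    rw [kernelForm_eq_sum, kernelForm_eq_sum, Finset.sum_comm]
    simp only [map_sum, inner_conj_symm, hL]
  re_inner_nonneg f := by
    classical
    rw [kernelForm_eq_sum]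
    let e := f.support.equivFin
    have := hpos _ (fun i => (e.symm i).1) (fun i => f (e.symm i).1)
    rw [← Finset.sum_coe_sort, ← Equiv.sum_comp e.symm]
    refine this.trans_eq (congrArg _ (Finset.sum_congr rfl fun i _ => ?_))
    rw [← Finset.sum_coe_sort f.support, ← Equiv.sum_comp e.symm]
  add_left := kernelForm_add_left L
  smul_left f g r := kernelForm_smul_left L r f g

/-- The difference of two Hermitian positive semidefinite kernels admits a minimal Krein space
linearisation. -/
lemma exists_kreinSpace_linearisation (L N : ∀ y x : ι, M x →L[𝕜] M y)
    (hL : ∀ x y h k, ⟪L y x h, k⟫_𝕜 = ⟪h, L x y k⟫_𝕜)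
    (hLpos : ∀ (n : ℕ) (x : Fin n → ι) (h : ∀ i, M (x i)),
      0 ≤ RCLike.re (∑ i, ∑ j, ⟪L (x j) (x i) (h i), h j⟫_𝕜))
    (hN : ∀ x y h k, ⟪N y x h, k⟫_𝕜 = ⟪h, N x y k⟫_𝕜)
    (hNpos : ∀ (n : ℕ) (x : Fin n → ι) (h : ∀ i, M (x i)),
      0 ≤ RCLike.re (∑ i, ∑ j, ⟪N (x j) (x i) (h i), h j⟫_𝕜)) :
    ∃ (Ks : KSp.{u, max v w} 𝕜) (V : ∀ i, M i →L[𝕜] Ks.carrier),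
      (∀ x y h k, ⟪Ks.J (V x h), V y k⟫_𝕜 = ⟪L y x h - N y x h, k⟫_𝕜) ∧
      ∀ f : Ks.carrier, (∀ x h, ⟪f, V x h⟫_𝕜 = 0) → f = 0 := by
  classical
  obtain ⟨Ks, T, c, hTd, hTb, hT⟩ :=
    exists_kreinSpace_of_cores (kernelCore L hL hLpos) (kernelCore N hN hNpos)
  have hbound : ∀ x (h : M x), ‖T (DFinsupp.single x h)‖ ≤
      (|c| * √(‖L x x‖ + ‖N x x‖)) * ‖h‖ := by
    intro x h
    refine abs_le_of_sq_le_sq' ?_ (by positivity) |>.2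
    refine (hTb _).trans ?_
    rw [mul_pow, mul_pow, sq_abs, Real.sq_sqrt (by positivity), mul_assoc]
    refine mul_le_mul_of_nonneg_left ?_ (sq_nonneg c)
    change RCLike.re (kernelForm L _ _ + kernelForm N _ _) ≤ _
    rw [kernelForm_single_single, kernelForm_single_single, map_add, add_mul]
    have hle : ∀ A : M x →L[𝕜] M x, RCLike.re ⟪A h, h⟫_𝕜 ≤ ‖A‖ * ‖h‖ ^ 2 := fun A =>
      calc RCLike.re ⟪A h, h⟫_𝕜 ≤ ‖A h‖ * ‖h‖ := re_inner_le_norm _ _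
        _ ≤ ‖A‖ * ‖h‖ * ‖h‖ := by gcongr; exact A.le_opNorm h
        _ = ‖A‖ * ‖h‖ ^ 2 := by ring
    exact add_le_add (hle _) (hle _)
  refine ⟨Ks, fun x => (T ∘ₗ DFinsupp.lsingle x).mkContinuous _ (hbound x),
    fun x y h k => ?_, fun f hf => ?_⟩
  · refine (hT _ _).trans ?_
    change kernelForm L _ _ - kernelForm N _ _ = _
    rw [DFinsupp.lsingle_apply, DFinsupp.lsingle_apply, kernelForm_single_single,
      kernelForm_single_single, inner_sub_left]
  · refine hTd.eq_of_inner_left 𝕜 fun u => ?_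
    rw [inner_zero_left]
    induction u using DFinsupp.induction with
    | h0 => simp
    | ha i b u _ _ ih =>
      rw [map_add, inner_add_right, ih, add_zero]
      exact hf i b

/-- A linear map on the span of a family of vectors can be prescribed on that family as soon as
all linear relations are respected. -/
lemma exists_linearMap_span {Kc D' : Type*} [AddCommGroup Kc] [Module 𝕜 Kc] [AddCommGroup D']
    [Module 𝕜 D'] [DecidableEq ι] (V : ∀ i, M i →ₗ[𝕜] Kc) (W : ∀ i, M i →ₗ[𝕜] D')
    (h : ∀ u, DFinsupp.lsum ℕ V u = 0 → DFinsupp.lsum ℕ W u = 0) (D : Submodule 𝕜 Kc)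
    (hD : D = Submodule.span 𝕜 (⋃ i, Set.range (V i))) :
    ∃ Φ : D →ₗ[𝕜] D', ∀ i k (hk : V i k ∈ D), Φ ⟨V i k, hk⟩ = W i k := by
  have hr : LinearMap.range (DFinsupp.lsum ℕ V) = D := by
    rw [hD]
    refine le_antisymm ?_ (Submodule.span_le.2 (Set.iUnion_subset fun i => ?_))
    · rintro _ ⟨u, rfl⟩
      induction u using DFinsupp.induction with
      | h0 => simp
      | ha i b u _ _ ih =>
        rw [map_add, DFinsupp.lsum_single]
        exact Submodule.add_mem _
          (Submodule.subset_span (Set.mem_iUnion.2 ⟨i, Set.mem_range_self b⟩)) ih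
    · rintro _ ⟨k, rfl⟩
      exact ⟨DFinsupp.single i k, DFinsupp.lsum_single _ _ _ _⟩
  subst hr
  obtain ⟨r, hr⟩ := LinearMap.exists_rightInverse_of_surjective
    (DFinsupp.lsum ℕ V).rangeRestrict (LinearMap.range_rangeRestrict _)
  refine ⟨DFinsupp.lsum ℕ W ∘ₗ r, fun i k hk => ?_⟩
  have h1 : DFinsupp.lsum ℕ V (r ⟨V i k, hk⟩) = V i k :=
    congrArg Subtype.val (LinearMap.congr_fun hr ⟨V i k, hk⟩)
  have h2 := h (r ⟨V i k, hk⟩ - DFinsupp.single i k) (by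
    rw [map_sub, h1, DFinsupp.lsum_single, sub_self])
  rwa [map_sub, DFinsupp.lsum_single, sub_eq_zero] at h2

end Kernel
end KreinAux

open KreinAux

section Casts

lemma castE_symm_castE_symm {E : O → Type w} [∀ o, NormedAddCommGroup (E o)]
    [∀ o, InnerProductSpace 𝕜 (E o)] {o₁ o₂ o₃ : O} (h : o₁ = o₂) (h' : o₂ = o₃) (k : E o₃) :
    (castE 𝕜 E h).symm ((castE 𝕜 E h').symm k) = (castE 𝕜 E (h.trans h')).symm k := by
  subst h h'; rfl

lemma castK_castK {𝒦 : S → KSp.{u, w'} 𝕜} {s t r : S} (h : s = t) (h' : t = r)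
    (f : (𝒦 s).carrier) : castK 𝕜 𝒦 h' (castK 𝕜 𝒦 h f) = castK 𝕜 𝒦 (h.trans h') f := by
  subst h h'; rfl

lemma castK_J {𝒦 : S → KSp.{u, w'} 𝕜} {s t : S} (h : s = t) (f : (𝒦 s).carrier) :
    (𝒦 t).J (castK 𝕜 𝒦 h f) = castK 𝕜 𝒦 h ((𝒦 s).J f) := by
  subst h; rfl

lemma coe_castSubK {𝒦 : S → KSp.{u, w'} 𝕜} (D : ∀ s : S, Submodule 𝕜 (𝒦 s).carrier) {s t : S}
    (h : s = t) (f : D s) : (castSubK D h f : (𝒦 t).carrier) = castK 𝕜 𝒦 h f := by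
  subst h; rfl

lemma castSubK_castSubK {𝒦 : S → KSp.{u, w'} 𝕜} (D : ∀ s : S, Submodule 𝕜 (𝒦 s).carrier)
    {s t r : S} (h : s = t) (h' : t = r) (f : D s) :
    castSubK D h' (castSubK D h f) = castSubK D (h.trans h') f := by
  subst h h'; rfl

end Casts

lemma KSp.inner_J_left (Ks : KSp.{u, w'} 𝕜) (f g : Ks.carrier) :
    ⟪Ks.J f, g⟫_𝕜 = ⟪f, Ks.J g⟫_𝕜 := by
  conv_lhs => rw [← Ks.J_adj]
  exact ContinuousLinearMap.adjoint_inner_left _ _ _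

lemma KSp.J_J (Ks : KSp.{u, w'} 𝕜) (f : Ks.carrier) : Ks.J (Ks.J f) = f :=
  DFunLike.congr_fun Ks.J_sq f

lemma KSp.norm_J (Ks : KSp.{u, w'} 𝕜) (f : Ks.carrier) : ‖Ks.J f‖ = ‖f‖ := by
  rw [← sq_eq_sq₀ (norm_nonneg _) (norm_nonneg _), ← inner_self_eq_norm_sq (𝕜 := 𝕜),
    ← inner_self_eq_norm_sq (𝕜 := 𝕜), KSp.inner_J_left, KSp.J_J]

variable {A p} in
lemma PartHermitian.inner_left {K : ∀ y x : X, E (p x) →L[𝕜] E (p y)} (hK : PartHermitian A p K)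
    {x y : X} (hxy : A.a x = A.a y) (h : E (p x)) (k : E (p y)) :
    ⟪K y x h, k⟫_𝕜 = ⟪h, K x y k⟫_𝕜 := by
  rw [← hK x y hxy, ContinuousLinearMap.adjoint_inner_left]

/-- A kernel dominated by a partially positive semidefinite kernel has a reproducing kernel Krein
space on every fibre of the anchor. -/
lemma nonempty_RKKSOn {K L : ∀ y x : X, E (p x) →L[𝕜] E (p y)} (hL : PartPSD A p L)
    (hKL : PKLE A p K L) (s : S) :
    Nonempty (RKKSOn.{u, uΓ, uS, v, vO, w, max v w} 𝕜 E A p K s) := by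
  obtain ⟨Ks, V, hV, hV0⟩ := exists_kreinSpace_linearisation
    (ι := {x : X // A.a x = s}) (M := fun x => E (p x.val))
    (fun y x => L y.val x.val) (fun y x => L y.val x.val - K y.val x.val)
    (fun x y h k => hL.1.inner_left (x.2.trans y.2.symm) h k)
    (fun n x h => hL.2 s n (fun i => (x i).val) (fun i => (x i).2) h)
    (fun x y h k => hKL.1.inner_left (x.2.trans y.2.symm) h k)
    (fun n x h => hKL.2 s n (fun i => (x i).val) (fun i => (x i).2) h)
  have hadj : ∀ f x (h : E (p x.val)),
      ⟪ContinuousLinearMap.adjoint (V x) (Ks.J f), h⟫_𝕜 = ⟪Ks.J f, V x h⟫_𝕜 := fun f x h =>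
    ContinuousLinearMap.adjoint_inner_left _ _ _
  refine ⟨{
    carrier := Ks.carrier
    J := Ks.J
    J_adj := Ks.J_adj
    J_sq := Ks.J_sq
    emb := LinearMap.pi fun x => (ContinuousLinearMap.adjoint (V x) ∘L Ks.J).toLinearMap
    emb_inj := ?_
    Kx := fun x h => V x h
    emb_Kx := fun x h y => ext_inner_right 𝕜 fun k => ?_
    repro := hadj }⟩
  · rw [← LinearMap.ker_eq_bot, LinearMap.ker_eq_bot']
    intro f hf
    rw [← Ks.J_J f, hV0 (Ks.J f) fun x h => ?_, map_zero]
    rw [← hadj]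
    have : ContinuousLinearMap.adjoint (V x) (Ks.J f) = 0 := congrFun hf x
    rw [this, inner_zero_left]
  · refine (hadj _ y k).trans ((hV x y h k).trans ?_)
    simp

section RKKS

variable {A p} {K : ∀ y x : X, E (p x) →L[𝕜] E (p y)}

section Fibre

variable {s : S} (R : RKKSOn.{u, uΓ, uS, v, vO, w, w'} 𝕜 E A p K s)

/-- The Krein space underlying a reproducing kernel Krein space. -/
abbrev toKSp : KSp.{u, w'} 𝕜 where
  carrier := R.carrier
  J := R.J
  J_adj := R.J_adj
  J_sq := R.J_sq

lemma RKKSOn.inner_J_Kx_Kx (x y : {x : X // A.a x = s}) (h : E (p x.val)) (k : E (p y.val)) :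
    ⟪R.J (R.Kx x h), R.Kx y k⟫_𝕜 = ⟪K y.val x.val h, k⟫_𝕜 := by
  rw [← R.repro, R.emb_Kx]

lemma RKKSOn.eq_zero_of_inner {f : R.carrier} (hf : ∀ x h, ⟪R.J f, R.Kx x h⟫_𝕜 = 0) : f = 0 := by
  refine R.emb_inj ?_
  rw [map_zero]
  funext x
  exact ext_inner_right 𝕜 fun h => by rw [R.repro, hf]; simp

/-- The kernel sections as linear maps. -/
def KxLin (x : {x : X // A.a x = s}) : E (p x.val) →ₗ[𝕜] R.carrier where
  toFun := R.Kx x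
  map_add' h k := R.emb_inj (by
    funext y; simp only [map_add, Pi.add_apply, R.emb_Kx])
  map_smul' r h := R.emb_inj (by
    funext y; simp only [map_smul, Pi.smul_apply, R.emb_Kx, RingHom.id_apply])

/-- The kernel sections as continuous linear maps; continuity follows from the closed graph
theorem. -/
def KxCLM (x : {x : X // A.a x = s}) : E (p x.val) →L[𝕜] R.carrier :=
  ⟨KxLin R x, (KxLin R x).continuous_of_seq_closed_graph fun u h y hu hy => by
    refine ext_inner_left 𝕜 fun f => ?_
    have h1 := (tendsto_const_nhds (x := f)).inner (𝕜 := 𝕜) hy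
    have h2 : Filter.Tendsto (fun n => ⟪f, KxLin R x (u n)⟫_𝕜) Filter.atTop
        (nhds ⟪f, KxLin R x h⟫_𝕜) := by
      have key : ∀ k, ⟪f, KxLin R x k⟫_𝕜 = ⟪R.emb (R.J f) x, k⟫_𝕜 := fun k => by
        rw [R.repro]
        exact congrArg (fun g => ⟪g, R.Kx x k⟫_𝕜) (KSp.J_J (toKSp R) f).symm
      simp only [key]
      exact tendsto_const_nhds.inner hu
    exact tendsto_nhds_unique h1 h2⟩

lemma RKKSOn.dense_span : Dense (Submodule.span 𝕜 (⋃ x : {x : X // A.a x = s},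
    Set.range (R.Kx x)) : Set R.carrier) := by
  rw [Submodule.dense_iff_topologicalClosure_eq_top, Submodule.topologicalClosure_eq_top_iff,
    eq_bot_iff]
  intro f hf
  have hJ : R.J f = 0 := by
    refine R.eq_zero_of_inner fun x h => ?_
    rw [show R.J (R.J f) = f from KSp.J_J (toKSp R) f]
    exact (Submodule.mem_orthogonal' _ _).1 hf _
      (Submodule.subset_span (Set.mem_iUnion.2 ⟨x, Set.mem_range_self h⟩))
  rw [Submodule.mem_bot, ← KSp.J_J (toKSp R) f]
  change R.J (R.J f) = 0
  rw [hJ, map_zero]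

end Fibre

variable {R : ∀ s : S, RKKSOn.{u, uΓ, uS, v, vO, w, w'} 𝕜 E A p K s}

lemma Kx_mem_DspanK {s : S} (x : {x : X // A.a x = s}) (h : E (p x.val)) :
    (R s).Kx x h ∈ DspanK A p K R s :=
  Submodule.subset_span (Set.mem_iUnion.mpr ⟨x, Set.mem_range_self h⟩)

lemma castDK_Kx {s t : S} (e : s = t) (x : X) (hx : A.a x = s) (h : E (p x)) :
    castDK A p e (⟨(R s).Kx ⟨x, hx⟩ h, Kx_mem_DspanK _ _⟩ : DspanK A p K R s) =
      ⟨(R t).Kx ⟨x, hx.trans e⟩ h, Kx_mem_DspanK _ _⟩ := by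
  subst e; rfl

lemma DspanK_induction {s : S} {P : DspanK A p K R s → Prop}
    (gen : ∀ (x : X) (hx : A.a x = s) (h : E (p x)),
      P ⟨(R s).Kx ⟨x, hx⟩ h, Kx_mem_DspanK _ _⟩)
    (zero : P 0) (sum : ∀ f g, P f → P g → P (f + g)) (smul : ∀ (r : 𝕜) f, P f → P (r • f))
    (f : DspanK A p K R s) : P f := by
  obtain ⟨f, hf⟩ := f
  induction hf using Submodule.span_induction with
  | mem f hf =>
    obtain ⟨x, h, rfl⟩ := Set.mem_iUnion.1 hf
    exact gen x.1 x.2 h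
  | zero => exact zero
  | add f g hf hg ihf ihg => exact sum ⟨f, hf⟩ ⟨g, hg⟩ ihf ihg
  | smul r f hf ih => exact smul r ⟨f, hf⟩ ih

lemma Kx_castE_congr {s : S} {x x' : X} (e : x = x') (hx : A.a x = s) (hx' : A.a x' = s) {o : O}
    (ho : p x = o) (ho' : p x' = o) (h : E o) :
    (R s).Kx ⟨x, hx⟩ ((castE 𝕜 E ho).symm h) = (R s).Kx ⟨x', hx'⟩ ((castE 𝕜 E ho').symm h) := by
  subst e; rfl

lemma GammaInvariant.inner_act (hp : ∀ {α : Γ} {x : X}, G.d α = A.a x → p (A.act α x) = p x)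
    (hK : PartHermitian A p K) (hG : GammaInvariant A p hp K) {α : Γ} {x y : X}
    (hx : G.d α = A.a x) (hy : G.c α = A.a y) (h : E (p x)) (k : E (p y)) :
    ⟪K y (A.act α x) ((castE 𝕜 E (hp hx)).symm h), k⟫_𝕜 =
      ⟪K (A.act (G.star α) y) x h,
        (castE 𝕜 E (hp ((G.d_star α).trans hy))).symm k⟫_𝕜 := by
  have hy' : A.a (A.act (G.star α) y) = A.a x :=
    (A.a_act ((G.d_star α).trans hy)).trans ((G.c_star α).trans hx)
  rw [hK.inner_left ((A.a_act hx).trans hy), hK.inner_left hy'.symm, ← hG α x y hx hy k,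
    ← LinearIsometryEquiv.inner_map_map (castE 𝕜 E (hp hx)),
    LinearIsometryEquiv.apply_symm_apply]

end RKKS
section Representation

variable {A p hp} {K : ∀ y x : X, E (p x) →L[𝕜] E (p y)}

/-- The shift by `α` on kernel sections extends to a linear map `D_{d(α)} → D_{c(α)}`. -/
lemma exists_shift_linearMap (hK : PartHermitian A p K) (hG : GammaInvariant A p hp K)
    (R : ∀ s : S, RKKSOn.{u, uΓ, uS, v, vO, w, w'} 𝕜 E A p K s) (α : Γ) :
    ∃ Φ : ↥(DspanK A p K R (G.d α)) →ₗ[𝕜] ↥(DspanK A p K R (G.c α)),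
      ∀ (x : X) (hx : G.d α = A.a x) (h : E (p x)),
        Φ ⟨(R (G.d α)).Kx ⟨x, hx.symm⟩ h, Kx_mem_DspanK _ _⟩ =
          ⟨(R (G.c α)).Kx ⟨A.act α x, A.a_act hx⟩ ((castE 𝕜 E (hp hx)).symm h),
            Kx_mem_DspanK _ _⟩ := by
  classical
  let W : ∀ x : {x : X // A.a x = G.d α}, E (p x.val) →ₗ[𝕜] ↥(DspanK A p K R (G.c α)) := fun x =>
    LinearMap.codRestrict _ (KxLin (R (G.c α)) ⟨A.act α x.val, A.a_act x.2.symm⟩ ∘ₗ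
      (castE 𝕜 E (hp x.2.symm)).symm.toLinearEquiv.toLinearMap) fun h => Kx_mem_DspanK _ _
  have hW : ∀ (u : Π₀ x : {x : X // A.a x = G.d α}, E (p x.val)) (y : X) (hy : A.a y = G.c α)
      (k : E (p y)),
      ⟪(R (G.c α)).J (DFinsupp.lsum ℕ W u : (R (G.c α)).carrier), (R (G.c α)).Kx ⟨y, hy⟩ k⟫_𝕜 =
        ⟪(R (G.d α)).J (DFinsupp.lsum ℕ (KxLin (R (G.d α))) u),
          (R (G.d α)).Kx ⟨A.act (G.star α) y,
            (A.a_act ((G.d_star α).trans hy.symm)).trans (G.c_star α)⟩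
            ((castE 𝕜 E (hp ((G.d_star α).trans hy.symm))).symm k)⟫_𝕜 := by
    intro u y hy k
    induction u using DFinsupp.induction with
    | h0 => simp
    | ha x h u _ _ ih =>
      rw [map_add, map_add, Submodule.coe_add, map_add, map_add, inner_add_left, inner_add_left,
        ih, DFinsupp.lsum_single, DFinsupp.lsum_single]
      congr 1
      exact ((R (G.c α)).inner_J_Kx_Kx _ _ _ _).trans
        ((hG.inner_act hp hK x.2.symm hy.symm h k).trans
          ((R (G.d α)).inner_J_Kx_Kx x ⟨A.act (G.star α) y,
            (A.a_act ((G.d_star α).trans hy.symm)).trans (G.c_star α)⟩ h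
            ((castE 𝕜 E (hp ((G.d_star α).trans hy.symm))).symm k)).symm)
  obtain ⟨Φ, hΦ⟩ := exists_linearMap_span (KxLin (R (G.d α))) W
    (fun u hu => Subtype.ext ((R (G.c α)).eq_zero_of_inner fun y k => by
      rw [hW u y.1 y.2 k, hu, map_zero, inner_zero_left]))
    (DspanK A p K R (G.d α)) rfl
  exact ⟨Φ, fun x hx h => hΦ ⟨x, hx.symm⟩ h _⟩

/-- Any family of linear maps acting on kernel sections by the shift is multiplicative. -/
lemma shift_mul {R : ∀ s : S, RKKSOn.{u, uΓ, uS, v, vO, w, w'} 𝕜 E A p K s}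
    {Φ : ∀ α : Γ, ↥(DspanK A p K R (G.d α)) →ₗ[𝕜] ↥(DspanK A p K R (G.c α))}
    (hΦ : ∀ (α : Γ) (x : X) (hx : G.d α = A.a x) (h : E (p x)),
      Φ α ⟨(R (G.d α)).Kx ⟨x, hx.symm⟩ h, Kx_mem_DspanK _ _⟩ =
        ⟨(R (G.c α)).Kx ⟨A.act α x, A.a_act hx⟩ ((castE 𝕜 E (hp hx)).symm h),
          Kx_mem_DspanK _ _⟩)
    (α β : Γ) (hc : G.d α = G.c β) (f : ↥(DspanK A p K R (G.d β))) :
    Φ (G.mul α β) (castDK A p (G.d_mul hc).symm f) =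
      castDK A p (G.c_mul hc).symm (Φ α (castDK A p hc.symm (Φ β f))) := by
  induction f using DspanK_induction with
  | gen x hx h =>
    have hβ := hΦ β x hx.symm h
    have hα := hΦ α (A.act β x) (hc.trans (A.a_act hx.symm).symm) ((castE 𝕜 E (hp hx.symm)).symm h)
    have hαβ := hΦ (G.mul α β) x ((G.d_mul hc).trans hx.symm) h
    rw [hβ, castDK_Kx, castDK_Kx, hα, castDK_Kx, hαβ]
    refine Subtype.ext ?_
    simp only [castE_symm_castE_symm]
    exact Kx_castE_congr (A.act_mul hx.symm hc) _ _ _ _ h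
  | zero => simp only [map_zero]
  | sum f g hf hg => simp only [map_add, hf, hg]
  | smul r f hf => simp only [map_smul, hf]

/-- Any family of linear maps acting on kernel sections by the shift satisfies the adjoint
relation if the kernel is `Γ`-invariant. -/
lemma shift_adj (hK : PartHermitian A p K) (hG : GammaInvariant A p hp K)
    {R : ∀ s : S, RKKSOn.{u, uΓ, uS, v, vO, w, w'} 𝕜 E A p K s}
    {Φ : ∀ α : Γ, ↥(DspanK A p K R (G.d α)) →ₗ[𝕜] ↥(DspanK A p K R (G.c α))}
    (hΦ : ∀ (α : Γ) (x : X) (hx : G.d α = A.a x) (h : E (p x)),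
      Φ α ⟨(R (G.d α)).Kx ⟨x, hx.symm⟩ h, Kx_mem_DspanK _ _⟩ =
        ⟨(R (G.c α)).Kx ⟨A.act α x, A.a_act hx⟩ ((castE 𝕜 E (hp hx)).symm h),
          Kx_mem_DspanK _ _⟩)
    (α : Γ) (f : ↥(DspanK A p K R (G.d α))) (g : ↥(DspanK A p K R (G.c α))) :
    ⟪(R (G.c α)).J ↑(Φ α f), (g : (R (G.c α)).carrier)⟫_𝕜 =
      ⟪(R (G.d α)).J ↑f, ((castDK A p (G.c_star α)
        (Φ (G.star α) (castDK A p (G.d_star α).symm g))) : (R (G.d α)).carrier)⟫_𝕜 := by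
  induction f using DspanK_induction with
  | gen x hx h =>
    induction g using DspanK_induction with
    | gen y hy k =>
      rw [hΦ α x hx.symm h, castDK_Kx,
        hΦ (G.star α) y ((G.d_star α).trans hy.symm) k, castDK_Kx]
      exact ((R (G.c α)).inner_J_Kx_Kx _ _ _ _).trans
        ((hG.inner_act hp hK hx.symm hy.symm h k).trans
          ((R (G.d α)).inner_J_Kx_Kx ⟨x, hx⟩ ⟨A.act (G.star α) y,
            (A.a_act ((G.d_star α).trans hy.symm)).trans (G.c_star α)⟩ h
            ((castE 𝕜 E (hp ((G.d_star α).trans hy.symm))).symm k)).symm)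
    | zero => simp only [map_zero, Submodule.coe_zero, inner_zero_right]
    | sum f g hf hg => simp only [map_add, Submodule.coe_add, inner_add_right, hf, hg]
    | smul r f hf => simp only [map_smul, Submodule.coe_smul, inner_smul_right, hf]
  | zero => simp only [map_zero, Submodule.coe_zero, inner_zero_left]
  | sum f g hf hg => simp only [map_add, Submodule.coe_add, inner_add_left, hf, hg]
  | smul r f hf => simp only [map_smul, Submodule.coe_smul, inner_smul_left, hf]

lemma castSubK_eq_castDK {R : ∀ s : S, RKKSOn.{u, uΓ, uS, v, vO, w, w'} 𝕜 E A p K s} {s t : S}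
    (e : s = t) (f : DspanK A p K R s) :
    castSubK (𝒦 := fun s => toKSp (R s)) (DspanK A p K R) e f = castDK A p e f := by
  subst e; rfl

lemma castK_Kx {R : ∀ s : S, RKKSOn.{u, uΓ, uS, v, vO, w, w'} 𝕜 E A p K s} {s t : S}
    (e : s = t) (x : X) (hx : A.a x = s) (h : E (p x)) :
    castK 𝕜 (fun s => toKSp (R s)) e ((R s).Kx ⟨x, hx⟩ h) = (R t).Kx ⟨x, hx.trans e⟩ h := by
  subst e; rfl

/-- Reproducing kernel Krein spaces with a generalised `*`-representation form a generalised
invariant Krein space linearisation. -/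
def genInvKLinOfRKKS (R : ∀ s : S, RKKSOn.{u, uΓ, uS, v, vO, w, w'} 𝕜 E A p K s)
    (Φ : ∀ α : Γ, ↥(DspanK A p K R (G.d α)) →ₗ[𝕜] ↥(DspanK A p K R (G.c α)))
    (hmul : ∀ (α β : Γ) (hc : G.d α = G.c β) (f : ↥(DspanK A p K R (G.d β))),
      Φ (G.mul α β) (castDK A p (G.d_mul hc).symm f) =
        castDK A p (G.c_mul hc).symm (Φ α (castDK A p hc.symm (Φ β f))))
    (hadj : ∀ (α : Γ) (f : ↥(DspanK A p K R (G.d α))) (g : ↥(DspanK A p K R (G.c α))),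
      ⟪(R (G.c α)).J ↑(Φ α f), (g : (R (G.c α)).carrier)⟫_𝕜 =
        ⟪(R (G.d α)).J ↑f, ((castDK A p (G.c_star α)
          (Φ (G.star α) (castDK A p (G.d_star α).symm g))) : (R (G.d α)).carrier)⟫_𝕜)
    (hΦ : ∀ (α : Γ) (x : X) (hx : G.d α = A.a x) (h : E (p x)),
      Φ α ⟨(R (G.d α)).Kx ⟨x, hx.symm⟩ h, Kx_mem_DspanK _ _⟩ =
        ⟨(R (G.c α)).Kx ⟨A.act α x, A.a_act hx⟩ ((castE 𝕜 E (hp hx)).symm h),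
          Kx_mem_DspanK _ _⟩) :
    GenInvKLin.{u, uΓ, uS, v, vO, w, w'} 𝕜 E A p hp K where
  Ksp s := toKSp (R s)
  D := DspanK A p K R
  dense_D s := (R s).dense_span
  V x := KxCLM (R (A.a x)) ⟨x, rfl⟩
  mem_D x h := Kx_mem_DspanK (R := R) ⟨x, rfl⟩ h
  lin x y hxy k h := by
    refine ((R (A.a x)).inner_J_Kx_Kx ⟨y, hxy⟩ ⟨x, rfl⟩ k h).symm.trans ?_
    rw [← castK_Kx hxy y rfl k]
    rfl
  Φ := Φ
  Φ_mul α β hc f := by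
    rw [castSubK_eq_castDK, castSubK_eq_castDK, castSubK_eq_castDK]
    exact hmul α β hc f
  Φ_adj α f g := by
    rw [castSubK_eq_castDK, castSubK_eq_castDK]
    exact hadj α f g
  Φ_shift α x hx h := by
    rw [castSubK_eq_castDK]
    refine (congrArg (fun f => (Φ α f : (R (G.c α)).carrier))
      (castDK_Kx (R := R) hx.symm x rfl h)).trans ?_
    rw [hΦ α x hx h]
    exact (castK_Kx (R := R) (A.a_act hx) (A.act α x) rfl _).symm

lemma isMinimalPartKLin_of_RKKS (R : ∀ s : S, RKKSOn.{u, uΓ, uS, v, vO, w, w'} 𝕜 E A p K s) :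
    IsMinimalPartKLin A p (fun s => toKSp (R s)) (fun x => KxCLM (R (A.a x)) ⟨x, rfl⟩) := by
  intro s
  refine (R s).dense_span.mono (Submodule.span_mono (Set.iUnion_mono fun x => ?_))
  rintro _ ⟨h, rfl⟩
  exact ⟨h, castK_Kx (R := R) x.2 x.1 rfl h⟩

/-- A kernel with a generalised invariant Krein space linearisation is `Γ`-invariant. -/
lemma GenInvKLin.gammaInvariant (L : GenInvKLin.{u, uΓ, uS, v, vO, w, w'} 𝕜 E A p hp K) :
    GammaInvariant A p hp K := by
  intro α x y hx hy k
  have hy' : G.d (G.star α) = A.a y := (G.d_star α).trans hy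
  refine ext_inner_right 𝕜 fun h => ?_
  have hadj := L.Φ_adj α (castSubK L.D hx.symm ⟨L.V x h, L.mem_D x h⟩)
    (castSubK L.D hy.symm ⟨L.V y k, L.mem_D y k⟩)
  rw [L.Φ_shift α x hx h, castSubK_castSubK, coe_castSubK, coe_castSubK, coe_castSubK,
    L.Φ_shift (G.star α) y hy' k, castK_castK] at hadj
  have h1 := L.lin (A.act α x) y (hy.symm.trans (A.a_act hx).symm) k
    ((castE 𝕜 E (hp hx)).symm h)
  have h2 := L.lin x (A.act (G.star α) y) (((A.a_act hy').trans (G.c_star α)).trans hx)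
    ((castE 𝕜 E (hp hy')).symm k) h
  have h3 : ⟪castE 𝕜 E (hp hx) (K (A.act α x) y k), h⟫_𝕜 =
      ⟪K (A.act α x) y k, (castE 𝕜 E (hp hx)).symm h⟫_𝕜 := by
    rw [← LinearIsometryEquiv.inner_map_map (castE 𝕜 E (hp hx)) (K (A.act α x) y k),
      LinearIsometryEquiv.apply_symm_apply]
  rw [h3, h1, h2, ← LinearIsometryEquiv.inner_map_map (castK 𝕜 L.Ksp (A.a_act hx)),
    ← castK_J, castK_castK, ← LinearIsometryEquiv.inner_map_map (castK 𝕜 L.Ksp hx.symm),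
    ← castK_J, castK_castK, KSp.inner_J_left, ← inner_conj_symm, hadj, inner_conj_symm,
    KSp.inner_J_left]

open Classical in
/-- The positive semidefinite kernel `V_x* V_y` associated with a linearisation. -/
def gramKernel (𝒦 : S → KSp.{u, w'} 𝕜) (V : ∀ x : X, E (p x) →L[𝕜] (𝒦 (A.a x)).carrier)
    (y x : X) : E (p x) →L[𝕜] E (p y) :=
  if hxy : A.a x = A.a y then
    ContinuousLinearMap.adjoint (V y) ∘L
      (castK 𝕜 𝒦 hxy).toContinuousLinearEquiv.toContinuousLinearMap ∘L V x
  else 0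

lemma inner_gramKernel {𝒦 : S → KSp.{u, w'} 𝕜} {V : ∀ x : X, E (p x) →L[𝕜] (𝒦 (A.a x)).carrier}
    {x y : X} {s : S} (hx : A.a x = s) (hy : A.a y = s) (h : E (p x)) (k : E (p y)) :
    ⟪gramKernel 𝒦 V y x h, k⟫_𝕜 = ⟪castK 𝕜 𝒦 hx (V x h), castK 𝕜 𝒦 hy (V y k)⟫_𝕜 := by
  subst hy
  rw [gramKernel, dif_pos hx]
  exact ContinuousLinearMap.adjoint_inner_left (V y) k (castK 𝕜 𝒦 hx (V x h))

lemma IsPartKreinLin.inner_kernel {𝒦 : S → KSp.{u, w'} 𝕜}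
    {V : ∀ x : X, E (p x) →L[𝕜] (𝒦 (A.a x)).carrier} (hV : IsPartKreinLin A p K 𝒦 V)
    {x y : X} {s : S} (hx : A.a x = s) (hy : A.a y = s) (h : E (p x)) (k : E (p y)) :
    ⟪K y x h, k⟫_𝕜 = ⟪(𝒦 s).J (castK 𝕜 𝒦 hx (V x h)), castK 𝕜 𝒦 hy (V y k)⟫_𝕜 := by
  subst hy
  exact hV y x hx h k

lemma partPSD_gramKernel (𝒦 : S → KSp.{u, w'} 𝕜)
    (V : ∀ x : X, E (p x) →L[𝕜] (𝒦 (A.a x)).carrier) : PartPSD A p (gramKernel 𝒦 V) := by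
  refine ⟨fun x y hxy => ?_, fun s n x hx h => ?_⟩
  · refine ((ContinuousLinearMap.eq_adjoint_iff _ _).2 fun h k => ?_).symm
    rw [inner_gramKernel hxy rfl, ← inner_conj_symm h, inner_gramKernel rfl hxy, inner_conj_symm]
  · have hsum : ∑ i, ∑ j, ⟪gramKernel 𝒦 V (x j) (x i) (h i), h j⟫_𝕜 =
        ⟪∑ i, castK 𝕜 𝒦 (hx i) (V (x i) (h i)), ∑ i, castK 𝕜 𝒦 (hx i) (V (x i) (h i))⟫_𝕜 := by
      simp only [sum_inner, inner_sum, inner_gramKernel (hx _) (hx _)]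
      exact Finset.sum_comm
    rw [hsum]
    exact inner_self_nonneg

/-- A partially Hermitian kernel with a Krein space linearisation is dominated by the associated
Gram kernel. -/
lemma IsPartKreinLin.pkle_gramKernel {𝒦 : S → KSp.{u, w'} 𝕜}
    {V : ∀ x : X, E (p x) →L[𝕜] (𝒦 (A.a x)).carrier} (hV : IsPartKreinLin A p K 𝒦 V)
    (hK : PartHermitian A p K) : PKLE A p K (gramKernel 𝒦 V) := by
  refine ⟨fun x y hxy => ?_, fun s n x hx h => ?_⟩
  · rw [map_sub, hK x y hxy, (partPSD_gramKernel 𝒦 V).1 x y hxy]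
  · set f := ∑ i, castK 𝕜 𝒦 (hx i) (V (x i) (h i)) with hf
    have hsum : ∑ i, ∑ j, ⟪(gramKernel 𝒦 V (x j) (x i) - K (x j) (x i)) (h i), h j⟫_𝕜 =
        ⟪f, f⟫_𝕜 - ⟪(𝒦 s).J f, f⟫_𝕜 := by
      simp only [hf, map_sum, sum_inner, inner_sum, sub_apply, inner_sub_left,
        inner_gramKernel (hx _) (hx _), hV.inner_kernel (hx _) (hx _), Finset.sum_sub_distrib]
      exact congrArg₂ _ Finset.sum_comm Finset.sum_comm
    rw [hsum, map_sub, inner_self_eq_norm_mul_norm, sub_nonneg]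
    simpa only [KSp.norm_J] using re_inner_le_norm (𝕜 := 𝕜) ((𝒦 s).J f) f

end Representation

/-- for a partially Hermitian kernel `K` the following are
equivalent: (1) `K` is `Γ`-invariant and dominated by a partially positive
semidefinite kernel `L`; (2) there exist reproducing kernel Krein spaces
`ℛ_{K^s}` and a generalised `*`-representation `Φ` on the subspaces
`D_s = span{K^s_x h}` with `Φ(α) K^{d(α)}_x h = K^{c(α)}_{α·x} h`; (3) there
is a minimal Krein space partial linearisation of `K` carrying a generalised
`*`-representation `Φ` with `Φ(α) V_x = V_{α·x}`. -/
theorem gamma_invariant_hermitian_kernel_tfae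
    (K : ∀ y x : X, E (p x) →L[𝕜] E (p y)) (hK : PartHermitian A p K) :
    ((GammaInvariant A p hp K ∧
        ∃ L : ∀ y x : X, E (p x) →L[𝕜] E (p y),
          PartPSD A p L ∧ PKLE A p K L) ↔
      (∃ (R : ∀ s : S, RKKSOn.{u, uΓ, uS, v, vO, w, max v w} 𝕜 E A p K s)
          (Φ : ∀ α : Γ,
            ↥(DspanK A p K R (G.d α)) →ₗ[𝕜] ↥(DspanK A p K R (G.c α))),
        (∀ (α β : Γ) (hc : G.d α = G.c β) (f : ↥(DspanK A p K R (G.d β))),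
          Φ (G.mul α β) (castDK A p (G.d_mul hc).symm f) =
            castDK A p (G.c_mul hc).symm
              (Φ α (castDK A p hc.symm (Φ β f)))) ∧
        (∀ (α : Γ) (f : ↥(DspanK A p K R (G.d α)))
            (g : ↥(DspanK A p K R (G.c α))),
          ⟪(R (G.c α)).J ↑(Φ α f), (g : (R (G.c α)).carrier)⟫_𝕜 =
            ⟪(R (G.d α)).J ↑f,
              ((castDK A p (G.c_star α)
                (Φ (G.star α) (castDK A p (G.d_star α).symm g))) :
                  (R (G.d α)).carrier)⟫_𝕜) ∧
        (∀ (α : Γ) (x : X) (hx : G.d α = A.a x) (h : E (p x)),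
          Φ α ⟨(R (G.d α)).Kx ⟨x, hx.symm⟩ h,
              Submodule.subset_span
                (Set.mem_iUnion.mpr ⟨⟨x, hx.symm⟩, Set.mem_range_self h⟩)⟩ =
            ⟨(R (G.c α)).Kx ⟨A.act α x, A.a_act hx⟩
                ((castE 𝕜 E (hp hx)).symm h),
              Submodule.subset_span
                (Set.mem_iUnion.mpr ⟨⟨A.act α x, A.a_act hx⟩,
                  Set.mem_range_self _⟩)⟩))) ∧
    ((GammaInvariant A p hp K ∧
        ∃ L : ∀ y x : X, E (p x) →L[𝕜] E (p y),
          PartPSD A p L ∧ PKLE A p K L) ↔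
      (∃ L : GenInvKLin.{u, uΓ, uS, v, vO, w, max v w} 𝕜 E A p hp K,
        IsMinimalPartKLin A p L.Ksp L.V)) := by
  have sections_of_dominated (h : GammaInvariant A p hp K ∧
      ∃ L : ∀ y x : X, E (p x) →L[𝕜] E (p y), PartPSD A p L ∧ PKLE A p K L) :
      ∃ (R : ∀ s : S, RKKSOn.{u, uΓ, uS, v, vO, w, max v w} 𝕜 E A p K s)
        (Φ : ∀ α : Γ, ↥(DspanK A p K R (G.d α)) →ₗ[𝕜] ↥(DspanK A p K R (G.c α))),
        ∀ (α : Γ) (x : X) (hx : G.d α = A.a x) (h : E (p x)),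
          Φ α ⟨(R (G.d α)).Kx ⟨x, hx.symm⟩ h, Kx_mem_DspanK _ _⟩ =
            ⟨(R (G.c α)).Kx ⟨A.act α x, A.a_act hx⟩ ((castE 𝕜 E (hp hx)).symm h),
              Kx_mem_DspanK _ _⟩ := by
    obtain ⟨hG, L, hL, hKL⟩ := h
    let R s := (nonempty_RKKSOn A p hL hKL s).some
    choose Φ hΦ using exists_shift_linearMap (hp := hp) hK hG R
    exact ⟨R, Φ, hΦ⟩
  have dominated_of_linearisation (L : GenInvKLin.{u, uΓ, uS, v, vO, w, max v w} 𝕜 E A p hp K) :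
      GammaInvariant A p hp K ∧
        ∃ L : ∀ y x : X, E (p x) →L[𝕜] E (p y), PartPSD A p L ∧ PKLE A p K L :=
    ⟨L.gammaInvariant, gramKernel L.Ksp L.V, partPSD_gramKernel L.Ksp L.V,
      IsPartKreinLin.pkle_gramKernel L.lin hK⟩
  refine ⟨⟨fun h => ?_, ?_⟩, ⟨fun h => ?_, fun ⟨L, _⟩ => dominated_of_linearisation L⟩⟩
  · obtain ⟨R, Φ, hΦ⟩ := sections_of_dominated h
    exact ⟨R, Φ, shift_mul hΦ, shift_adj hK h.1 hΦ, hΦ⟩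
  · rintro ⟨R, Φ, hmul, hadj, hΦ⟩
    exact dominated_of_linearisation (genInvKLinOfRKKS R Φ hmul hadj hΦ)
  · obtain ⟨R, Φ, hΦ⟩ := sections_of_dominated h
    exact ⟨genInvKLinOfRKKS R Φ (shift_mul hΦ) (shift_adj hK h.1 hΦ) hΦ,
      isMinimalPartKLin_of_RKKS R⟩
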